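/- Let μ be the measure on Ω with density dμ/dν = exp(−H). There exists a Borel set Ω′ ⊆ Ω with ν(Ω′) = 1 (hence also of full μ-measure relative to μ's total mass) such that: (i) for every ω ∈ Ω′, H(1ω_{[1,∞)}) < ∞; (ii) for all ω, η ∈ Ω′ and each ξ_0 ∈ {0,1}, H(ξ_0 ω_{[1,n]} η_{[n+1,∞)}) → H(ξ_0 ω_{[1,∞)}) and γ_0(ξ_0 | ω_{[1,n]} η_{[n+1,∞)}) → γ_0(ξ_0 | ω_{[1,∞)}) as n → ∞; and (iii) for every ω ∈ Ω′ and each ξ_0 ∈ {0,1}, μ([ξ_0] ∩ [ω_{[1,n]}]) / μ([ω_{[1,n]}]) → γ_0(ξ_0 | ω_{[1,∞)}) as n → ∞ (every ω ∈ Ω′ is regular in Goldstein's sense). -/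

import Mathlib

open MeasureTheory Filter Topology
open scoped ENNReal

namespace WeakGibbsExample

/-- Configuration space `Ω = {0,1}^{ℤ≥0}`. -/
abbrev Conf := ℕ → Bool

/-- `ν` is the Bernoulli(1/2,1/2) product measure on `{0,1}^{ℤ≥0}`:
a probability measure giving each cylinder on a finite set `s` measure `2^{-|s|}`. -/
def IsBernoulliHalf (ν : Measure Conf) : Prop :=
  IsProbabilityMeasure ν ∧
    ∀ (s : Finset ℕ) (f : ℕ → Bool),
      ν {ζ | ∀ i ∈ s, ζ i = f i} = (2 : ℝ≥0∞)⁻¹ ^ s.card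

/-- `N_m(ω)`: the length of the maximal run of `1`s in `ω` ending at site `m`
(`0` if `ω m = 0`). -/
def runLen (ω : Conf) (m : ℕ) : ℕ :=
  Nat.findGreatest (fun j => 0 < j ∧ ∀ i < j, ω (m - i) = true) (m + 1)

/-- The potential term `U([0,2p], ω) = ω_0 ω_{2p} ρ^{p - N_{2p}(ω)} 𝟙{N_{2p}(ω) ≤ p}`. -/
noncomputable def U (ρ : ℝ) (ω : Conf) (p : ℕ) : ℝ :=
  if ω 0 = true ∧ ω (2 * p) = true ∧ runLen ω (2 * p) ≤ p then
    ρ ^ (p - runLen ω (2 * p))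
  else 0

/-- The Hamiltonian `H(ω) = Σ_{n ≥ 1} U([0,2n], ω) ∈ [0,∞]`. -/
noncomputable def H (ρ : ℝ) (ω : Conf) : ℝ≥0∞ :=
  ∑' n : ℕ, ENNReal.ofReal (U ρ ω (n + 1))

/-- `B_k = {η : η_j = 1 for all ⌊3k/2⌋ ≤ j ≤ 2k}`. -/
def Bk (k : ℕ) : Set Conf :=
  {η | ∀ j, 3 * k / 2 ≤ j → j ≤ 2 * k → η j = true}

/-- `B = ⋂_K ⋃_{k ≥ K} B_k`. -/
def Bbad : Set Conf :=
  ⋂ K : ℕ, ⋃ k : ℕ, ⋃ _ : K ≤ k, Bk k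

/-- `b ζ`: the configuration with symbol `b` at site `0` and agreeing with `ζ` on sites `≥ 1`. -/
def consb (b : Bool) (ζ : Conf) : Conf := fun i => if i = 0 then b else ζ i

/-- `1ζ`. -/
def one (ζ : Conf) : Conf := consb true ζ

/-- The glued configuration equal to `ω` on `[0,n]` and to `η` on `[n+1,∞)`. -/
def glue (ω η : Conf) (n : ℕ) : Conf := fun i => if i ≤ n then ω i else η i

/-- `γ_0(b | ζ_{[1,∞)})`, the single-site conditional probability computed from the
Hamiltonian (the value of `ζ` at site `0` is ignored). -/
noncomputable def gamma0 (ρ : ℝ) (b : Bool) (ζ : Conf) : ℝ :=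
  if b then
    Real.exp (-(H ρ (one ζ)).toReal) / (1 + Real.exp (-(H ρ (one ζ)).toReal))
  else 1 / (1 + Real.exp (-(H ρ (one ζ)).toReal))

/-- The cylinder `[ω_{[1,n]}] = {ζ : ζ_i = ω_i for 1 ≤ i ≤ n}`. -/
def cylTail (ω : Conf) (n : ℕ) : Set Conf :=
  {ζ | ∀ i, 1 ≤ i → i ≤ n → ζ i = ω i}

/-- `A^ω_{ε,n}`: the set of exterior configurations `η` for which the glued configuration
`ω_{[1,n]} η_{[n+1,∞)}` moves the single-site conditional probabilities by more than `ε`. -/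
noncomputable def Abad (ρ : ℝ) (ω : Conf) (ε : ℝ) (n : ℕ) : Set Conf :=
  {η | ∃ b : Bool, ε < |gamma0 ρ b (glue ω η n) - gamma0 ρ b ω|}

/-- The density `exp(-H(ζ))` (equal to `0` when `H(ζ) = ∞`). -/
noncomputable def expH (ρ : ℝ) (ζ : Conf) : ℝ≥0∞ :=
  if H ρ ζ = ⊤ then 0 else ENNReal.ofReal (Real.exp (-(H ρ ζ).toReal))

/-! ### Elementary properties of the potential -/

/-- `ω` has a zero among its last sites before `m`, at distance at most `m / 8`,
for all large `m`. -/
def ShortRuns (ω : Conf) : Prop :=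
  ∀ᶠ m in atTop, ∃ i, 8 * i ≤ m ∧ ω (m - i) = false

lemma summable_pow_div {r : ℝ} (h0 : 0 ≤ r) (h1 : r < 1) (k : ℕ) [NeZero k] :
    Summable fun n : ℕ => r ^ (n / k) := by
  have hprod : Summable fun x : ℕ × Fin k => r ^ x.1 * 1 :=
    (summable_geometric_of_lt_one h0 h1).mul_of_nonneg
      (g := fun _ : Fin k => (1 : ℝ)) (Summable.of_finite)
      (fun n => pow_nonneg h0 n) (fun _ => zero_le_one)
  have := (Nat.divModEquiv k).summable_iff.mpr hprod
  simpa [Function.comp_def, Nat.divModEquiv] using this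

lemma runLen_le {ω : Conf} {m i : ℕ} (h : ω (m - i) = false) : runLen ω m ≤ i := by
  by_contra! hlt
  have hspec := Nat.findGreatest_of_ne_zero (m := runLen ω m) rfl (by omega)
  simpa [h] using hspec.2 i hlt

lemma runLen_congr {ω ω' : Conf} {m : ℕ} (h : ∀ i ≤ m, ω i = ω' i) :
    runLen ω m = runLen ω' m := by
  have hfun : ∀ i, ω (m - i) = ω' (m - i) := fun i => h _ (Nat.sub_le _ _)
  simp only [runLen, hfun]

lemma U_congr (ρ : ℝ) {ω ω' : Conf} {p : ℕ} (h : ∀ i ≤ 2 * p, ω i = ω' i) :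
    U ρ ω p = U ρ ω' p := by
  simp only [U, runLen_congr h, h 0 (Nat.zero_le _), h (2 * p) le_rfl]

lemma U_nonneg {ρ : ℝ} (h0 : 0 ≤ ρ) (ω : Conf) (p : ℕ) : 0 ≤ U ρ ω p := by
  unfold U
  split_ifs
  · positivity
  · exact le_rfl

lemma U_le_one {ρ : ℝ} (h0 : 0 ≤ ρ) (h1 : ρ ≤ 1) (ω : Conf) (p : ℕ) : U ρ ω p ≤ 1 := by
  unfold U
  split_ifs
  · exact pow_le_one₀ h0 h1
  · exact zero_le_one

lemma U_le_pow {ρ : ℝ} (h0 : 0 ≤ ρ) (h1 : ρ ≤ 1) {ω : Conf} {p i : ℕ} (hi : 2 * i ≤ p)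
    (h : ω (2 * p - i) = false) : U ρ ω p ≤ ρ ^ (p / 2) := by
  unfold U
  split_ifs
  · exact pow_le_pow_of_le_one h0 h1 (by have := runLen_le h; omega)
  · positivity

lemma H_eq_zero (ρ : ℝ) {ω : Conf} (h : ω 0 = false) : H ρ ω = 0 := by
  simp [H, U, h]

lemma glue_consb (b : Bool) (ω η : Conf) (n : ℕ) :
    glue (consb b ω) η n = consb b (glue ω η n) := by
  funext i
  by_cases hi : i = 0 <;> simp [glue, consb, hi]

lemma glue_self (ω : Conf) (n : ℕ) : glue ω ω n = ω := by
  funext i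
  simp [glue]

lemma ShortRuns.consb {ω : Conf} (h : ShortRuns ω) (b : Bool) : ShortRuns (consb b ω) := by
  filter_upwards [h, eventually_ge_atTop 1] with m hm hm1
  obtain ⟨i, hi, hz⟩ := hm
  refine ⟨i, hi, ?_⟩
  rw [WeakGibbsExample.consb, if_neg (by omega), hz]

/-- Gluing two configurations with short runs yields runs that are short uniformly in the
gluing position. -/
lemma ShortRuns.glue {ω η : Conf} (hω : ShortRuns ω) (hη : ShortRuns η) :
    ∃ M, ∀ n ≥ M, ∀ m ≥ M, ∃ i, 4 * i ≤ m ∧ glue ω η n (m - i) = false := by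
  obtain ⟨M, hM⟩ := eventually_atTop.mp (hω.and hη)
  refine ⟨M, fun n hn m hm => ?_⟩
  rcases le_or_gt m n with hmn | hmn
  · obtain ⟨i, hi, hz⟩ := (hM m hm).1
    exact ⟨i, by omega, by rw [WeakGibbsExample.glue, if_pos (by omega), hz]⟩
  · obtain ⟨i, hi, hz⟩ := (hM m hm).2
    by_cases hin : m - i ≤ n
    · obtain ⟨j, hj, hzj⟩ := (hM n hn).1
      refine ⟨m - n + j, by omega, ?_⟩
      rw [show m - (m - n + j) = n - j by omega, WeakGibbsExample.glue, if_pos (by omega), hzj]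
    · exact ⟨i, by omega, by rw [WeakGibbsExample.glue, if_neg hin, hz]⟩

lemma summable_U {ρ : ℝ} (hρ : ρ ∈ Set.Ioo (0 : ℝ) 1) {ω : Conf} {M : ℕ}
    (h : ∀ m ≥ M, ∃ i, 4 * i ≤ m ∧ ω (m - i) = false) :
    Summable fun p => U ρ ω (p + 1) := by
  have hpow : Summable fun p : ℕ => ρ ^ ((p + 1) / 2) :=
    (summable_nat_add_iff 1).mpr (summable_pow_div hρ.1.le hρ.2 2)
  refine Summable.of_norm_bounded_eventually_nat hpow ?_
  filter_upwards [eventually_ge_atTop M] with p hp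
  obtain ⟨i, hi, hz⟩ := h (2 * (p + 1)) (by omega)
  rw [Real.norm_of_nonneg (U_nonneg hρ.1.le _ _)]
  exact U_le_pow hρ.1.le hρ.2.le (by omega) hz

lemma H_eq_ofReal_tsum {ρ : ℝ} (hρ : ρ ∈ Set.Ioo (0 : ℝ) 1) {ω : Conf} {M : ℕ}
    (h : ∀ m ≥ M, ∃ i, 4 * i ≤ m ∧ ω (m - i) = false) :
    H ρ ω = ENNReal.ofReal (∑' p, U ρ ω (p + 1)) :=
  (ENNReal.ofReal_tsum_of_nonneg (fun _ => U_nonneg hρ.1.le _ _) (summable_U hρ h)).symm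

lemma ShortRuns.H_lt_top {ρ : ℝ} (hρ : ρ ∈ Set.Ioo (0 : ℝ) 1) {ω : Conf} (h : ShortRuns ω) :
    H ρ ω < ⊤ := by
  obtain ⟨M, hM⟩ := h.glue h
  have hω := hM M le_rfl
  rw [glue_self] at hω
  rw [H_eq_ofReal_tsum hρ hω]
  exact ENNReal.ofReal_lt_top

lemma ShortRuns.tendsto_H_glue {ρ : ℝ} (hρ : ρ ∈ Set.Ioo (0 : ℝ) 1) {ω η : Conf}
    (hω : ShortRuns ω) (hη : ShortRuns η) :
    Tendsto (fun n => H ρ (WeakGibbsExample.glue ω η n)) atTop (𝓝 (H ρ ω)) := by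
  obtain ⟨M, hM⟩ := hω.glue hη
  obtain ⟨M', hM'⟩ := hω.glue hω
  have hω' := hM' M' le_rfl
  rw [glue_self] at hω'
  rw [H_eq_ofReal_tsum hρ hω']
  have hpow : Summable fun p : ℕ => ρ ^ ((p + 1) / 2) :=
    (summable_nat_add_iff 1).mpr (summable_pow_div hρ.1.le hρ.2 2)
  have hbound : Summable fun p : ℕ => if p < M then (1 : ℝ) else ρ ^ ((p + 1) / 2) := by
    refine Summable.of_norm_bounded_eventually_nat hpow ?_
    filter_upwards [eventually_ge_atTop M] with p hp
    rw [if_neg (by omega), Real.norm_of_nonneg (pow_nonneg hρ.1.le _)]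
  have htend : Tendsto (fun n => ∑' p, U ρ (WeakGibbsExample.glue ω η n) (p + 1)) atTop
      (𝓝 (∑' p, U ρ ω (p + 1))) := by
    refine tendsto_tsum_of_dominated_convergence hbound (fun p => ?_) ?_
    · refine tendsto_const_nhds.congr' ?_
      filter_upwards [eventually_ge_atTop (2 * (p + 1))] with n hn
      refine U_congr ρ fun i hi => ?_
      rw [WeakGibbsExample.glue, if_pos (by omega)]
    · filter_upwards [eventually_ge_atTop M] with n hn p
      rw [Real.norm_of_nonneg (U_nonneg hρ.1.le _ _)]
      split_ifs with hp
      · exact U_le_one hρ.1.le hρ.2.le _ _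
      · obtain ⟨i, hi, hz⟩ := hM n hn (2 * (p + 1)) (by omega)
        exact U_le_pow hρ.1.le hρ.2.le (by omega) hz
  refine (ENNReal.tendsto_ofReal htend).congr' ?_
  filter_upwards [eventually_ge_atTop M] with n hn
  exact (H_eq_ofReal_tsum hρ (hM n hn)).symm

/-! ### The density `exp(-H)` -/

lemma expH_le_one (ρ : ℝ) (ω : Conf) : expH ρ ω ≤ 1 := by
  unfold expH
  split_ifs
  · exact zero_le_one
  · exact ENNReal.ofReal_le_one.mpr (Real.exp_le_one_iff.mpr (by simp))

lemma expH_eq_one (ρ : ℝ) {ω : Conf} (h : ω 0 = false) : expH ρ ω = 1 := by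
  simp [expH, H_eq_zero ρ h]

lemma tendsto_expH {ρ : ℝ} {x : ℕ → Conf} {ω : Conf} (hω : H ρ ω < ⊤)
    (h : Tendsto (fun n => H ρ (x n)) atTop (𝓝 (H ρ ω))) :
    Tendsto (fun n => expH ρ (x n)) atTop (𝓝 (expH ρ ω)) := by
  have hreal := (ENNReal.tendsto_toReal hω.ne).comp h
  have hexp := ENNReal.tendsto_ofReal ((Real.continuous_exp.tendsto _).comp hreal.neg)
  rw [expH, if_neg hω.ne]
  refine hexp.congr' ?_
  filter_upwards [h.eventually_lt_const hω] with n hn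
  simp [expH, hn.ne]

lemma toReal_expH {ρ : ℝ} {ω : Conf} (h : H ρ ω < ⊤) :
    (expH ρ ω).toReal = Real.exp (-(H ρ ω).toReal) := by
  rw [expH, if_neg h.ne, ENNReal.toReal_ofReal (Real.exp_pos _).le]

lemma gamma0_eq {ρ : ℝ} {ω : Conf} (h : H ρ (one ω) < ⊤) (b : Bool) :
    gamma0 ρ b ω = (expH ρ (consb b ω)).toReal /
      ((expH ρ (consb true ω)).toReal + (expH ρ (consb false ω)).toReal) := by
  have hf : expH ρ (consb false ω) = 1 := expH_eq_one ρ (by simp [consb])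
  have ht : (expH ρ (consb true ω)).toReal = Real.exp (-(H ρ (one ω)).toReal) := toReal_expH h
  cases b <;> simp [gamma0, hf, ht, add_comm]

lemma measurableSet_coord (i : ℕ) (b : Bool) : MeasurableSet {ω : Conf | ω i = b} :=
  measurableSet_eq_fun (measurable_pi_apply i) measurable_const

lemma measurable_runLen (m : ℕ) : Measurable fun ω : Conf => runLen ω m := by
  refine measurable_findGreatest fun k _ => ?_
  have hset : {ω : Conf | 0 < k ∧ ∀ i < k, ω (m - i) = true} =
      {_ω : Conf | 0 < k} ∩ ⋂ i, ⋂ _ : i < k, {ω : Conf | ω (m - i) = true} := by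
    ext ω
    simp
  rw [hset]
  exact (MeasurableSet.const _).inter (MeasurableSet.iInter fun i => MeasurableSet.iInter fun _ =>
    measurableSet_coord (m - i) true)

lemma measurable_U (ρ : ℝ) (p : ℕ) : Measurable fun ω => U ρ ω p := by
  have hrun := measurable_runLen (2 * p)
  refine Measurable.ite ?_ ?_ measurable_const
  · have hset : {ω : Conf | ω 0 = true ∧ ω (2 * p) = true ∧ runLen ω (2 * p) ≤ p} =
        {ω : Conf | ω 0 = true} ∩ ({ω : Conf | ω (2 * p) = true} ∩
          {ω : Conf | runLen ω (2 * p) ≤ p}) := by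
      ext ω
      simp
    rw [hset]
    exact (measurableSet_coord 0 true).inter ((measurableSet_coord (2 * p) true).inter
      (measurableSet_le hrun measurable_const))
  · exact (measurable_from_nat (f := fun k => ρ ^ (p - k))).comp hrun

lemma measurable_H (ρ : ℝ) : Measurable (H ρ) :=
  Measurable.tsum fun n => (measurable_U ρ (n + 1)).ennreal_ofReal

lemma measurable_expH (ρ : ℝ) : Measurable (expH ρ) :=
  Measurable.ite (measurable_H ρ (measurableSet_singleton ⊤)) measurable_const
    (Real.measurable_exp.comp (measurable_H ρ).ennreal_toReal.neg).ennreal_ofReal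

/-! ### Cylinders and the product structure of `ν` -/

/-- The cylinder of configurations agreeing with `f` on the finite set `s`. -/
def cylinderAt (s : Finset ℕ) (f : Conf) : Set Conf := {ζ | ∀ i ∈ s, ζ i = f i}

lemma measurableSet_cylinderAt (s : Finset ℕ) (f : Conf) : MeasurableSet (cylinderAt s f) := by
  have hset : cylinderAt s f = ⋂ i ∈ s, {ζ : Conf | ζ i = f i} := by
    ext ζ
    simp [cylinderAt]
  rw [hset]
  exact Finset.measurableSet_biInter _ fun i _ =>
    measurableSet_coord i (f i)

lemma cylinderAt_inter {s t : Finset ℕ} {f g ζ : Conf} (hf : ζ ∈ cylinderAt s f)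
    (hg : ζ ∈ cylinderAt t g) :
    cylinderAt s f ∩ cylinderAt t g = cylinderAt (s ∪ t) ζ := by
  ext ξ
  simp only [cylinderAt, Set.mem_inter_iff, Set.mem_ofPred_eq, Finset.mem_union] at hf hg ⊢
  constructor
  · rintro ⟨h1, h2⟩ i (hi | hi)
    · rw [h1 i hi, hf i hi]
    · rw [h2 i hi, hg i hi]
  · intro h
    exact ⟨fun i hi => by rw [h i (.inl hi), hf i hi], fun i hi => by rw [h i (.inr hi), hg i hi]⟩

/-- Finite measures on `Conf` that agree on cylinders are equal. -/
lemma ext_of_cylinderAt {μ₁ μ₂ : Measure Conf} [IsFiniteMeasure μ₁]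
    (h : ∀ s f, μ₁ (cylinderAt s f) = μ₂ (cylinderAt s f)) : μ₁ = μ₂ := by
  refine ext_of_generate_finite {A | ∃ s f, A = cylinderAt s f} ?_ ?_ ?_ ?_
  · apply le_antisymm
    · refine iSup_le fun i => ?_
      rintro _ ⟨B, -, rfl⟩
      have hcover : (fun ζ : Conf => ζ i) ⁻¹' B =
          ⋃ b ∈ B, cylinderAt {i} (fun _ => b) := by
        ext ζ
        simp [cylinderAt]
      rw [hcover]
      exact MeasurableSet.biUnion B.to_countable fun b _ =>
        MeasurableSpace.measurableSet_generateFrom ⟨_, _, rfl⟩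
    · refine MeasurableSpace.generateFrom_le ?_
      rintro _ ⟨s, f, rfl⟩
      exact measurableSet_cylinderAt s f
  · rintro _ ⟨s, f, rfl⟩ _ ⟨t, g, rfl⟩ ⟨ζ, hf, hg⟩
    exact ⟨s ∪ t, ζ, cylinderAt_inter hf hg⟩
  · rintro _ ⟨s, f, rfl⟩
    exact h s f
  · simpa [cylinderAt] using h ∅ (fun _ => true)

lemma measurable_glue (ω : Conf) (n : ℕ) : Measurable fun η => glue ω η n := by
  refine measurable_pi_lambda _ fun i => ?_
  by_cases hi : i ≤ n
  · simp only [glue, if_pos hi, measurable_const]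
  · simpa only [glue, if_neg hi] using measurable_pi_apply i

lemma preimage_glue_cylinderAt {s : Finset ℕ} {f ω : Conf} {n : ℕ}
    (h : ∀ i ∈ s, i ≤ n → ω i = f i) :
    (fun η => glue ω η n) ⁻¹' cylinderAt s f = cylinderAt (s \ Finset.range (n + 1)) f := by
  ext η
  simp only [cylinderAt, glue, Set.mem_preimage, Set.mem_ofPred_eq, Finset.mem_sdiff,
    Finset.mem_range]
  constructor
  · rintro hη i ⟨hi, hin⟩
    simpa [show ¬ i ≤ n by omega] using hη i hi
  · intro hη i hi
    split_ifs with hin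
    · exact h i hi hin
    · exact hη i ⟨hi, by omega⟩

/-- Conditionally on the sites `[0,n]`, the remaining sites are again Bernoulli. -/
lemma IsBernoulliHalf.restrict_cylinderAt {ν : Measure Conf} (hν : IsBernoulliHalf ν)
    (ω : Conf) (n : ℕ) :
    ν.restrict (cylinderAt (Finset.range (n + 1)) ω) =
      (2 : ℝ≥0∞)⁻¹ ^ (n + 1) • ν.map (fun η => glue ω η n) := by
  have := hν.1
  refine ext_of_cylinderAt fun s f => ?_
  rw [Measure.restrict_apply (measurableSet_cylinderAt s f), Measure.smul_apply,
    Measure.map_apply (measurable_glue ω n) (measurableSet_cylinderAt s f), smul_eq_mul]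
  have hcyl : ∀ t g, ν (cylinderAt t g) = (2 : ℝ≥0∞)⁻¹ ^ t.card := hν.2
  by_cases h : ∀ i ∈ s, i ≤ n → ω i = f i
  · have hmem : glue ω f n ∈ cylinderAt s f := fun i hi => by
      by_cases hin : i ≤ n
      · simpa [glue, hin] using h i hi hin
      · simp [glue, hin]
    have hmem' : glue ω f n ∈ cylinderAt (Finset.range (n + 1)) ω := fun i hi => by
      simp [glue, Nat.lt_succ_iff.mp (Finset.mem_range.mp hi)]
    rw [cylinderAt_inter hmem hmem', preimage_glue_cylinderAt h, hcyl, hcyl, ← pow_add,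
      ← Finset.card_sdiff_add_card, Finset.card_range, add_comm]
  · push Not at h
    obtain ⟨i, his, hin, hne⟩ := h
    have h1 : cylinderAt s f ∩ cylinderAt (Finset.range (n + 1)) ω = ∅ := by
      refine Set.eq_empty_of_forall_notMem fun ζ hζ => hne ?_
      rw [← hζ.2 i (Finset.mem_range.mpr (by omega)), hζ.1 i his]
    have h2 : (fun η => glue ω η n) ⁻¹' cylinderAt s f = ∅ := by
      refine Set.eq_empty_of_forall_notMem fun ζ hζ => hne ?_
      simpa [glue, hin] using hζ i his
    simp [h1, h2]

lemma IsBernoulliHalf.ae_shortRuns {ν : Measure Conf} (hν : IsBernoulliHalf ν) :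
    ∀ᵐ ω ∂ν, ShortRuns ω := by
  have hsum : ∑' m : ℕ, (2 : ℝ≥0∞)⁻¹ ^ (m / 8) ≠ ⊤ := by
    have hreal := (summable_pow_div (r := 2⁻¹) (by norm_num) (by norm_num) 8).tsum_ofReal_ne_top
    simpa only [ENNReal.ofReal_pow (inv_nonneg.mpr zero_le_two), ENNReal.ofReal_inv_of_pos two_pos,
      ENNReal.ofReal_ofNat] using hreal
  have hmeas : ∀ m : ℕ, ν {ω | ¬ ∃ i, 8 * i ≤ m ∧ ω (m - i) = false} ≤
      (2 : ℝ≥0∞)⁻¹ ^ (m / 8) := fun m => by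
    have hset : {ω : Conf | ¬ ∃ i, 8 * i ≤ m ∧ ω (m - i) = false} ⊆
        cylinderAt (Finset.Ioc (m - m / 8) m) (fun _ => true) := by
      intro ω hω i hi
      simp only [Set.mem_ofPred_eq, not_exists, not_and, Bool.not_eq_false] at hω
      rw [Finset.mem_Ioc] at hi
      have := hω (m - i) (by omega)
      rwa [show m - (m - i) = i by omega] at this
    refine (measure_mono hset).trans (le_of_eq ?_)
    refine (hν.2 _ _).trans ?_
    rw [Nat.card_Ioc, show m - (m - m / 8) = m / 8 by omega]
  filter_upwards [ae_eventually_notMem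
    (ne_top_of_le_ne_top hsum (ENNReal.tsum_le_tsum hmeas))] with ω hω
  filter_upwards [hω] with m hm
  simpa only [Set.mem_ofPred_eq, not_not] using hm

lemma measurableSet_shortRuns : MeasurableSet {ω | ShortRuns ω} := by
  have hset : {ω | ShortRuns ω} = ⋃ M : ℕ, ⋂ m : ℕ, ⋂ _ : M ≤ m, ⋃ i : ℕ, ⋃ _ : 8 * i ≤ m,
      {ω : Conf | ω (m - i) = false} := by
    ext ω
    simp [ShortRuns, eventually_atTop]
  rw [hset]
  exact .iUnion fun M => .iInter fun m => .iInter fun _ => .iUnion fun i => .iUnion fun _ =>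
    measurableSet_coord (m - i) false

lemma inter_cylTail (ω : Conf) (b : Bool) (n : ℕ) :
    {ζ : Conf | ζ 0 = b} ∩ cylTail ω n = cylinderAt (Finset.range (n + 1)) (consb b ω) := by
  ext ζ
  simp only [cylTail, cylinderAt, consb, Set.mem_inter_iff, Set.mem_ofPred_eq, Finset.mem_range]
  constructor
  · rintro ⟨h0, h⟩ i hi
    split_ifs with hi0
    · rw [hi0, h0]
    · exact h i (by omega) (by omega)
  · intro h
    refine ⟨by simpa using h 0 (by omega), fun i hi hin => ?_⟩
    simpa [show i ≠ 0 by omega] using h i (by omega)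

lemma IsBernoulliHalf.withDensity_inter_cylTail {ν : Measure Conf} (hν : IsBernoulliHalf ν)
    (ρ : ℝ) (ω : Conf) (b : Bool) (n : ℕ) :
    ν.withDensity (expH ρ) ({ζ | ζ 0 = b} ∩ cylTail ω n) =
      (2 : ℝ≥0∞)⁻¹ ^ (n + 1) * ∫⁻ η, expH ρ (consb b (glue ω η n)) ∂ν := by
  rw [inter_cylTail, withDensity_apply _ (measurableSet_cylinderAt _ _),
    hν.restrict_cylinderAt, lintegral_smul_measure,
    lintegral_map (measurable_expH ρ) (measurable_glue _ n), smul_eq_mul]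
  simp only [glue_consb]

lemma measure_cylTail (μ : Measure Conf) (ω : Conf) (n : ℕ) :
    μ (cylTail ω n) = μ ({ζ | ζ 0 = true} ∩ cylTail ω n) + μ ({ζ | ζ 0 = false} ∩ cylTail ω n) := by
  have hm : MeasurableSet {ζ : Conf | ζ 0 = true} :=
    measurableSet_coord 0 true
  rw [← measure_inter_add_sdiff (cylTail ω n) hm]
  congr 2
  · exact Set.inter_comm _ _
  · ext ζ
    simp [and_comm]

lemma IsBernoulliHalf.tendsto_lintegral_expH {ρ : ℝ} (hρ : ρ ∈ Set.Ioo (0 : ℝ) 1)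
    {ν : Measure Conf} (hν : IsBernoulliHalf ν) {ω : Conf} (hω : ShortRuns ω) (b : Bool) :
    Tendsto (fun n => ∫⁻ η, expH ρ (consb b (glue ω η n)) ∂ν) atTop
      (𝓝 (expH ρ (consb b ω))) := by
  have := hν.1
  have hlim : Tendsto (fun n => ∫⁻ η, expH ρ (consb b (glue ω η n)) ∂ν) atTop
      (𝓝 (∫⁻ _, expH ρ (consb b ω) ∂ν)) := by
    refine tendsto_lintegral_of_dominated_convergence (fun _ => 1) (fun n => ?_)
      (fun n => .of_forall fun η => expH_le_one ρ _) (by simp) ?_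
    · simp only [← glue_consb]
      exact (measurable_expH ρ).comp (measurable_glue _ n)
    · filter_upwards [hν.ae_shortRuns] with η hη
      simp only [← glue_consb]
      exact tendsto_expH ((hω.consb b).H_lt_top hρ) ((hω.consb b).tendsto_H_glue hρ hη)
  simpa using hlim

/-- Configurations with short runs are regular in Goldstein's sense. -/
lemma IsBernoulliHalf.tendsto_cylTail_ratio {ρ : ℝ} (hρ : ρ ∈ Set.Ioo (0 : ℝ) 1)
    {ν : Measure Conf} (hν : IsBernoulliHalf ν) {ω : Conf} (hω : ShortRuns ω) (b : Bool) :
    Tendsto (fun n : ℕ => (ν.withDensity (expH ρ) ({ζ | ζ 0 = b} ∩ cylTail ω n)).toReal /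
      (ν.withDensity (expH ρ) (cylTail ω n)).toReal) atTop (𝓝 (gamma0 ρ b ω)) := by
  have := hν.1
  set L : Bool → ℕ → ℝ≥0∞ := fun c n => ∫⁻ η, expH ρ (consb c (glue ω η n)) ∂ν
  have hLtop : ∀ c n, L c n ≠ ⊤ := fun c n => by
    refine ne_top_of_le_ne_top ENNReal.one_ne_top ?_
    calc L c n ≤ ∫⁻ _, 1 ∂ν := lintegral_mono fun _ => expH_le_one ρ _
      _ = 1 := by simp
  have hreal : ∀ c, Tendsto (fun n => (L c n).toReal) atTop
      (𝓝 (expH ρ (consb c ω)).toReal) := fun c =>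
    (ENNReal.tendsto_toReal (ne_top_of_le_ne_top ENNReal.one_ne_top (expH_le_one ρ _))).comp
      (hν.tendsto_lintegral_expH hρ hω c)
  have hden : (expH ρ (consb true ω)).toReal + (expH ρ (consb false ω)).toReal ≠ 0 := by
    rw [expH_eq_one ρ (ω := consb false ω) (by simp [consb]), ENNReal.toReal_one]
    positivity
  rw [gamma0_eq ((hω.consb true).H_lt_top hρ)]
  refine ((hreal b).div ((hreal true).add (hreal false)) hden).congr fun n => ?_
  rw [measure_cylTail]
  simp only [hν.withDensity_inter_cylTail]
  rw [← mul_add, ENNReal.toReal_mul, ENNReal.toReal_mul, mul_div_mul_left _ _ (by simp),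
    ENNReal.toReal_add (hLtop true n) (hLtop false n)]
  rfl

lemma tendsto_gamma0 {ρ : ℝ} {x : ℕ → Conf} {ω : Conf} (hω : H ρ (one ω) < ⊤)
    (h : Tendsto (fun n => H ρ (one (x n))) atTop (𝓝 (H ρ (one ω)))) (b : Bool) :
    Tendsto (fun n => gamma0 ρ b (x n)) atTop (𝓝 (gamma0 ρ b ω)) := by
  have hexp := (Real.continuous_exp.tendsto _).comp
    ((ENNReal.tendsto_toReal hω.ne).comp h).neg
  have hne : 1 + Real.exp (-(H ρ (one ω)).toReal) ≠ 0 := by positivity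
  cases b
  · simpa [gamma0] using (hexp.const_add 1).inv₀ hne
  · simpa [gamma0, Pi.div_def] using hexp.div (hexp.const_add 1) hne

/-- The weak Gibbs measure `μ = exp(-H) dν` admits a full-measure set `Ω'`
of configurations on which the potential is convergent, on which the Hamiltonians and the
single-site conditional probabilities of glued configurations converge, and every point of
which is regular in Goldstein's sense. -/
theorem exists_regular_set
    (ρ : ℝ) (hρ : ρ ∈ Set.Ioo (0 : ℝ) 1)
    (ν : Measure Conf) (hν : IsBernoulliHalf ν)
    (μ : Measure Conf) (hμ : μ = ν.withDensity (expH ρ)) :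
    ∃ Ω' : Set Conf, MeasurableSet Ω' ∧ ν Ω' = 1 ∧ μ Ω'ᶜ = 0 ∧
      (∀ ω ∈ Ω', H ρ (one ω) < ⊤) ∧
      (∀ ω ∈ Ω', ∀ η ∈ Ω', ∀ b : Bool,
        Tendsto (fun n : ℕ => H ρ (consb b (glue ω η n))) atTop
          (nhds (H ρ (consb b ω))) ∧
        Tendsto (fun n : ℕ => gamma0 ρ b (glue ω η n)) atTop (nhds (gamma0 ρ b ω))) ∧
      (∀ ω ∈ Ω', ∀ b : Bool,
        Tendsto
          (fun n : ℕ =>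
            (μ ({ζ | ζ 0 = b} ∩ cylTail ω n)).toReal / (μ (cylTail ω n)).toReal)
          atTop (nhds (gamma0 ρ b ω))) := by
  have := hν.1
  subst hμ
  have hone : ν {ω | ShortRuns ω} = 1 := (mem_ae_iff_prob_eq_one measurableSet_shortRuns).mp hν.ae_shortRuns
  refine ⟨{ω | ShortRuns ω}, measurableSet_shortRuns, hone, ?_, ?_, ?_, ?_⟩
  · exact withDensity_absolutelyContinuous ν (expH ρ) hν.ae_shortRuns
  · exact fun ω hω => (ShortRuns.consb hω true).H_lt_top hρ
  · intro ω hω η hη b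
    have hH : ∀ c, Tendsto (fun n : ℕ => H ρ (consb c (glue ω η n))) atTop
        (𝓝 (H ρ (consb c ω))) := fun c => by
      simp only [← glue_consb]
      exact (ShortRuns.consb hω c).tendsto_H_glue hρ hη
    exact ⟨hH b, tendsto_gamma0 ((ShortRuns.consb hω true).H_lt_top hρ) (hH true) b⟩
  · exact fun ω hω b => hν.tendsto_cylTail_ratio hρ hω b

end WeakGibbsExample
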